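/- arXiv:2404.11059 — 5 statements merged into one kernel-verified Lean document; each statement's English description precedes it below -/
import Mathlib

section
/- Let 𝒞 be a class of finite groups, closed under isomorphism, which satisfies: (1) if Y is a normal subgroup of X and X ∈ 𝒞, then X/Y ∈ 𝒞; and (2) if X/Φ(X) ∈ 𝒞, where Φ(X) is the Frattini subgroup of X, then X ∈ 𝒞. If N is a normal subgroup of a finite group G and G/N ∈ 𝒞, then there exists a subgroup H of G such that H ∈ 𝒞 and G = HN. -/
universe u

/-- A class of finite groups closed under isomorphism which is closed under quotients and
such that `X ∈ 𝒞` whenever `X/Φ(X) ∈ 𝒞` admits "supplements": if `N ⊴ G` and `G/N ∈ 𝒞`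
then there is a subgroup `H ∈ 𝒞` with `G = HN`. -/
theorem abelian_supplements_stmt_0
    (C : ∀ (X : Type u) [Group X] [Finite X], Prop)
    (hiso : ∀ (X : Type u) [Group X] [Finite X] (Y : Type u) [Group Y] [Finite Y],
      Nonempty (X ≃* Y) → C X → C Y)
    (hquot : ∀ (X : Type u) [Group X] [Finite X] (Y : Subgroup X) [Y.Normal],
      C X → C (X ⧸ Y))
    (hfrat : ∀ (X : Type u) [Group X] [Finite X], C (X ⧸ frattini X) → C X)
    (G : Type u) [Group G] [Finite G] (N : Subgroup G) [N.Normal]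
    (hGN : C (G ⧸ N)) :
    ∃ H : Subgroup G, C H ∧ H ⊔ N = ⊤ := by
  obtain ⟨H, hH⟩ := exists_minimal_of_wellFoundedLT (fun H : Subgroup G => H ⊔ N = ⊤)
    ⟨⊤, by simp⟩
  refine ⟨H, ?_, hH.prop⟩
  let f : H →* G ⧸ N := (QuotientGroup.mk' N).comp H.subtype
  have hf : Function.Surjective f := by
    intro q
    obtain ⟨g, rfl⟩ := QuotientGroup.mk_surjective q
    have hg : g ∈ H ⊔ N := by rw [hH.prop]; trivial
    obtain ⟨h, hh, n, hn, rfl⟩ := Subgroup.mem_sup_of_normal_right.1 hg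
    refine ⟨⟨h, hh⟩, ?_⟩
    change (QuotientGroup.mk h : G ⧸ N) = QuotientGroup.mk (h * n)
    rw [QuotientGroup.eq]
    simpa using hn
  have hker : ∀ x : H, x ∈ f.ker → (x : G) ∈ N := by
    intro x hx
    exact (QuotientGroup.eq_one_iff (x : G)).1 hx
  have hle : f.ker ≤ frattini H := by
    simp only [frattini, Order.radical, le_iInf_iff]
    intro M hM
    by_contra hKM
    have hsup : M ⊔ f.ker = ⊤ := hM.2 _ (left_lt_sup.2 hKM)
    have hHle : H ≤ M.map H.subtype ⊔ N := by
      have h1 : (M ⊔ f.ker).map H.subtype = H := by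
        rw [hsup, ← MonoidHom.range_eq_map, Subgroup.range_subtype]
      rw [Subgroup.map_sup] at h1
      refine h1.ge.trans (sup_le_sup_left ?_ _)
      rintro _ ⟨x, hx, rfl⟩
      exact hker x hx
    have htop : M.map H.subtype ⊔ N = ⊤ := by
      apply top_le_iff.1
      rw [← hH.prop]
      exact sup_le hHle le_sup_right
    have hHM : H ≤ M.map H.subtype := hH.le_of_le htop (Subgroup.map_subtype_le M)
    apply hM.1
    rw [eq_top_iff]
    intro x _
    obtain ⟨y, hy, hyx⟩ := hHM x.2
    have : y = x := Subtype.ext hyx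
    exact this ▸ hy
  have h1 : C (H ⧸ f.ker) :=
    hiso _ _ ⟨(QuotientGroup.quotientKerEquivOfSurjective f hf).symm⟩ hGN
  have h2 := hquot _ ((frattini H).map (QuotientGroup.mk' f.ker)) h1
  exact hfrat _ (hiso _ _ ⟨QuotientGroup.quotientQuotientEquivQuotient f.ker (frattini H) hle⟩ h2)
end

section
/- Let q ≥ 4 be a prime power and let G be a finite almost simple group whose socle G₀ is isomorphic to PSL(2,q). Then G contains an abelian subgroup A such that G = A·G₀. -/
namespace AbSup
open Matrix

variable {F : Type*} [Field F]

abbrev SL (F : Type*) [Field F] := Matrix.SpecialLinearGroup (Fin 2) F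
abbrev PS (F : Type*) [Field F] := SL F ⧸ Subgroup.center (SL F)

def mk4 (a b c d : F) (h : a * d - b * c = 1) : SL F :=
  ⟨!![a, b; c, d], by rw [Matrix.det_fin_two]; exact h⟩
@[simp] theorem mk00 (a b c d : F) (h : a * d - b * c = 1) : (mk4 a b c d h) 0 0 = a := rfl
@[simp] theorem mk01 (a b c d : F) (h : a * d - b * c = 1) : (mk4 a b c d h) 0 1 = b := rfl
@[simp] theorem mk10 (a b c d : F) (h : a * d - b * c = 1) : (mk4 a b c d h) 1 0 = c := rfl
@[simp] theorem mk11 (a b c d : F) (h : a * d - b * c = 1) : (mk4 a b c d h) 1 1 = d := rfl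

def up (x : F) : SL F := ⟨!![1, x; 0, 1], by simp [Matrix.det_fin_two]⟩
def lo (x : F) : SL F := ⟨!![1, 0; x, 1], by simp [Matrix.det_fin_two]⟩
def ww (F : Type*) [Field F] : SL F := ⟨!![0, -1; 1, 0], by simp [Matrix.det_fin_two]⟩
def dg (a : Fˣ) : SL F := ⟨!![(a : F), 0; 0, ((a⁻¹ : Fˣ) : F)], by simp [Matrix.det_fin_two]⟩

abbrev pr (A : SL F) : PS F := QuotientGroup.mk A

theorem det_eq (A : SL F) : A 0 0 * A 1 1 - A 0 1 * A 1 0 = 1 := by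
  have := A.2
  rwa [Matrix.det_fin_two] at this

theorem ext4 {A B : SL F} (h1 : A 0 0 = B 0 0) (h2 : A 0 1 = B 0 1) (h3 : A 1 0 = B 1 0)
    (h4 : A 1 1 = B 1 1) : A = B := by
  ext i j
  fin_cases i <;> fin_cases j <;> assumption

theorem mul00 (A B : SL F) : (A * B) 0 0 = A 0 0 * B 0 0 + A 0 1 * B 1 0 := by
  simp [Matrix.mul_apply, Fin.sum_univ_two]
theorem mul01 (A B : SL F) : (A * B) 0 1 = A 0 0 * B 0 1 + A 0 1 * B 1 1 := by
  simp [Matrix.mul_apply, Fin.sum_univ_two]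
theorem mul10 (A B : SL F) : (A * B) 1 0 = A 1 0 * B 0 0 + A 1 1 * B 1 0 := by
  simp [Matrix.mul_apply, Fin.sum_univ_two]
theorem mul11 (A B : SL F) : (A * B) 1 1 = A 1 0 * B 0 1 + A 1 1 * B 1 1 := by
  simp [Matrix.mul_apply, Fin.sum_univ_two]

@[simp] theorem up00 (x : F) : (up x) 0 0 = 1 := rfl
@[simp] theorem up01 (x : F) : (up x) 0 1 = x := rfl
@[simp] theorem up10 (x : F) : (up x) 1 0 = 0 := rfl
@[simp] theorem up11 (x : F) : (up x) 1 1 = 1 := rfl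
@[simp] theorem lo00 (x : F) : (lo x) 0 0 = 1 := rfl
@[simp] theorem lo01 (x : F) : (lo x) 0 1 = 0 := rfl
@[simp] theorem lo10 (x : F) : (lo x) 1 0 = x := rfl
@[simp] theorem lo11 (x : F) : (lo x) 1 1 = 1 := rfl
@[simp] theorem ww00 : (ww F) 0 0 = 0 := rfl
@[simp] theorem ww01 : (ww F) 0 1 = -1 := rfl
@[simp] theorem ww10 : (ww F) 1 0 = 1 := rfl
@[simp] theorem ww11 : (ww F) 1 1 = 0 := rfl
@[simp] theorem dg00 (a : Fˣ) : (dg a) 0 0 = a := rfl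
@[simp] theorem dg01 (a : Fˣ) : (dg a) 0 1 = 0 := rfl
@[simp] theorem dg10 (a : Fˣ) : (dg a) 1 0 = 0 := rfl
@[simp] theorem dg11 (a : Fˣ) : (dg a) 1 1 = ((a⁻¹ : Fˣ) : F) := rfl
theorem neg_ij (A : SL F) (i j) : (-A) i j = - A i j := rfl

/-- equality in `PSL(2,F)` -/
theorem pr_eq {A B : SL F} : pr A = pr B ↔ A = B ∨ A = -B := by
  rw [QuotientGroup.eq, Matrix.SpecialLinearGroup.mem_center_iff]
  constructor
  · rintro ⟨r, hr, h⟩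
    simp only [Fintype.card_fin] at hr
    have hB : B = A * (A⁻¹ * B) := by group
    have hr' : r = 1 ∨ r = -1 := by
      have : (r - 1) * (r + 1) = 0 := by linear_combination hr
      rcases mul_eq_zero.mp this with h | h
      · left; linear_combination h
      · right; linear_combination h
    rcases hr' with rfl | rfl
    · left
      have : A⁻¹ * B = 1 := by ext i j; rw [← h]; simp
      rw [hB, this, mul_one]
    · right
      have : A⁻¹ * B = -1 := by
        ext i j
        rw [← h]
        fin_cases i <;> fin_cases j <;> simp
      rw [hB, this]; simp
  · rintro (rfl | rfl)
    · exact ⟨1, by simp, by simp⟩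
    · exact ⟨-1, by simp, by ext i j; fin_cases i <;> fin_cases j <;> simp⟩

def Dm (a : Fˣ) : MulAut (SL F) where
  toFun A := mk4 (A 0 0) (a * A 0 1) (((a⁻¹ : Fˣ) : F) * A 1 0) (A 1 1) (by
    have := det_eq A
    have h : (a : F) * ((a⁻¹ : Fˣ) : F) = 1 := a.mul_inv
    linear_combination this - A 0 1 * A 1 0 * h)
  invFun A := mk4 (A 0 0) (((a⁻¹ : Fˣ) : F) * A 0 1) (a * A 1 0) (A 1 1) (by
    have := det_eq A
    have h : (a : F) * ((a⁻¹ : Fˣ) : F) = 1 := a.mul_inv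
    linear_combination this - A 0 1 * A 1 0 * h)
  left_inv A := by
    apply ext4 <;> simp
  right_inv A := by
    apply ext4 <;> simp
  map_mul' A B := by
    have h : (a : F) * ((a⁻¹ : Fˣ) : F) = 1 := a.mul_inv
    apply ext4 <;> simp only [mul00, mul01, mul10, mul11, mk00, mk01, mk10, mk11]
    · linear_combination - A 0 1 * B 1 0 * h
    · ring
    · ring
    · linear_combination - A 1 0 * B 0 1 * h

def Fm (s : F ≃+* F) : MulAut (SL F) where
  toFun A := mk4 (s (A 0 0)) (s (A 0 1)) (s (A 1 0)) (s (A 1 1)) (by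
    have := congrArg s (det_eq A)
    simpa using this)
  invFun A := mk4 (s.symm (A 0 0)) (s.symm (A 0 1)) (s.symm (A 1 0)) (s.symm (A 1 1)) (by
    have := congrArg s.symm (det_eq A)
    simpa using this)
  left_inv A := by
    apply ext4 <;> simp
  right_inv A := by
    apply ext4 <;> simp
  map_mul' A B := by
    apply ext4 <;> simp only [mul00, mul01, mul10, mul11, mk00, mk01, mk10, mk11] <;> simp

@[simp] theorem Dm00 (a : Fˣ) (A : SL F) : (Dm a A) 0 0 = A 0 0 := rfl
@[simp] theorem Dm01 (a : Fˣ) (A : SL F) : (Dm a A) 0 1 = a * A 0 1 := rfl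
@[simp] theorem Dm10 (a : Fˣ) (A : SL F) : (Dm a A) 1 0 = ((a⁻¹ : Fˣ) : F) * A 1 0 := rfl
@[simp] theorem Dm11 (a : Fˣ) (A : SL F) : (Dm a A) 1 1 = A 1 1 := rfl
@[simp] theorem Fm00 (s : F ≃+* F) (A : SL F) : (Fm s A) 0 0 = s (A 0 0) := rfl
@[simp] theorem Fm01 (s : F ≃+* F) (A : SL F) : (Fm s A) 0 1 = s (A 0 1) := rfl
@[simp] theorem Fm10 (s : F ≃+* F) (A : SL F) : (Fm s A) 1 0 = s (A 1 0) := rfl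
@[simp] theorem Fm11 (s : F ≃+* F) (A : SL F) : (Fm s A) 1 1 = s (A 1 1) := rfl

theorem Dm_mul (a b : Fˣ) : (Dm (a * b) : MulAut (SL F)) = Dm a * Dm b := by
  ext1 A
  rw [MulAut.mul_apply]
  apply ext4 <;> simp <;> ring

theorem Dm_one : (Dm 1 : MulAut (SL F)) = 1 := by
  ext1 A
  apply ext4 <;> simp

theorem Fm_mul (s t : F ≃+* F) : (Fm (s * t) : MulAut (SL F)) = Fm s * Fm t := by
  ext1 A
  rw [MulAut.mul_apply]
  apply ext4 <;> simp

theorem Fm_one : (Fm 1 : MulAut (SL F)) = 1 := by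
  ext1 A
  apply ext4 <;> simp

theorem Fm_Dm (s : F ≃+* F) (a : Fˣ) :
    Fm s * Dm a = Dm (Units.map (s : F →* F) a) * Fm s := by
  ext1 A
  rw [MulAut.mul_apply, MulAut.mul_apply]
  apply ext4 <;> simp

theorem Dm_sq (a : Fˣ) : (Dm (a * a) : MulAut (SL F)) = MulAut.conj (dg a) := by
  ext1 A
  rw [MulAut.conj_apply, eq_mul_inv_iff_mul_eq]
  apply ext4 <;> simp [mul00, mul01, mul10, mul11] <;> field_simp

/-- the key commutation -/
theorem key_comm (s : F ≃+* F) (c n : Fˣ) (h : s (n : F) = c * c * n) :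
    (Dm c⁻¹ * Fm s) * (Dm n * MulAut.conj (ww F)) =
      (Dm n * MulAut.conj (ww F)) * (Dm c⁻¹ * Fm s) := by
  have e : ∀ A : SL F, ww F * A * (ww F)⁻¹ = mk4 (A 1 1) (- A 1 0) (- A 0 1) (A 0 0)
      (by have := det_eq A; linear_combination this) := by
    intro A
    rw [mul_inv_eq_iff_eq_mul]
    apply ext4 <;> simp only [mul00, mul01, mul10, mul11, mk00, mk01, mk10, mk11] <;> simp
  ext1 A
  simp only [MulAut.mul_apply, MulAut.conj_apply, e]
  apply ext4 <;> simp [h] <;> field_simp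

/-- the induced automorphism on the quotient -/
noncomputable def qm (F : Type*) [Field F] : MulAut (SL F) →* MulAut (PS F) where
  toFun f := QuotientGroup.congr _ _ f (Subgroup.characteristic_iff_map_eq.mp inferInstance f)
  map_one' := by
    ext x
    induction x using QuotientGroup.induction_on
    rfl
  map_mul' f g := by
    ext x
    induction x using QuotientGroup.induction_on
    rfl

@[simp] theorem qm_pr (f : MulAut (SL F)) (A : SL F) : qm F f (pr A) = pr (f A) := rfl

theorem qm_conj (B : SL F) : qm F (MulAut.conj B) = MulAut.conj (pr B) := by
  ext x
  induction x using QuotientGroup.induction_on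
  rfl

theorem cyc [Finite F] : IsCyclic (F ≃+* F) := by
  obtain ⟨p, _⟩ := CharP.exists F
  have : Fact p.Prime := ⟨CharP.char_is_prime F p⟩
  let _ : Algebra (ZMod p) F := ZMod.algebra F p
  let f : (F ≃ₐ[ZMod p] F) →* (F ≃+* F) :=
    { toFun := fun e => e.toRingEquiv, map_one' := rfl, map_mul' := fun _ _ => rfl }
  refine isCyclic_of_surjective f ?_
  intro e
  refine ⟨AlgEquiv.ofRingEquiv (f := e) ?_, ?_⟩
  · intro x
    exact DFunLike.congr_fun (Subsingleton.elim (e.toRingHom.comp (algebraMap (ZMod p) F)) (algebraMap (ZMod p) F)) x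
  · ext; rfl

end AbSup

namespace AbSup
open Matrix

variable {F : Type*} [Field F]

theorem pr_mul (A B : SL F) : pr (A * B) = pr A * pr B := rfl

theorem ent {A B : SL F} (h : pr A = pr B) :
    ∃ e : F, e * e = 1 ∧ A 0 0 = e * B 0 0 ∧ A 0 1 = e * B 0 1 ∧ A 1 0 = e * B 1 0 ∧
      A 1 1 = e * B 1 1 := by
  rcases pr_eq.mp h with rfl | rfl
  · exact ⟨1, by simp⟩
  · exact ⟨-1, by simp [neg_ij]⟩

theorem sgn {e : F} (h : e * e = 1) : e = 1 ∨ e = -1 := by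
  have : (e - 1) * (e + 1) = 0 := by linear_combination h
  rcases mul_eq_zero.mp this with h | h
  · left; linear_combination h
  · right; linear_combination h

theorem of_ent {A B : SL F} (e : F) (he : e * e = 1) (h0 : A 0 0 = e * B 0 0)
    (h1 : A 0 1 = e * B 0 1) (h2 : A 1 0 = e * B 1 0) (h3 : A 1 1 = e * B 1 1) : pr A = pr B := by
  rw [pr_eq]
  rcases sgn he with rfl | rfl
  · left; apply ext4 <;> simp [*]
  · right; apply ext4 <;> simp [neg_ij, *]

theorem up_add (x y : F) : up (x + y) = up x * up y := by
  apply ext4 <;> simp [mul00, mul01, mul10, mul11, add_comm]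
theorem lo_add (x y : F) : lo (x + y) = lo x * lo y := by
  apply ext4 <;> simp [mul00, mul01, mul10, mul11]
theorem up_zero : up (0 : F) = 1 := by
  apply ext4 <;> simp
theorem lo_zero : lo (0 : F) = 1 := by
  apply ext4 <;> simp
theorem up_inj {x y : F} (h : pr (up x) = pr (up y)) : x = y := by
  obtain ⟨e, he, h0, h1, h2, h3⟩ := ent h
  simp at h0 h1
  subst h0; simpa using h1
theorem lo_inj {x y : F} (h : pr (lo x) = pr (lo y)) : x = y := by
  obtain ⟨e, he, h0, h1, h2, h3⟩ := ent h
  simp at h0 h2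
  subst h0; simpa using h2

theorem ww_up (x : F) : ww F * up x * (ww F)⁻¹ = lo (-x) := by
  rw [mul_inv_eq_iff_eq_mul]
  apply ext4 <;> simp [mul00, mul01, mul10, mul11]

theorem comm_up {M : SL F} {b : F} (hb : b ≠ 0) (h : pr M * pr (up b) = pr (up b) * pr M) :
    ∃ x, pr M = pr (up x) := by
  rw [← pr_mul, ← pr_mul] at h
  obtain ⟨e, he, h0, h1, h2, h3⟩ := ent h
  simp [mul00, mul01, mul10, mul11] at h0 h1 h2 h3
  have hd := det_eq M
  have main : M 1 0 = 0 ∧ M 0 0 = M 1 1 := by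
    have key : e = 1 → M 1 0 = 0 ∧ M 0 0 = M 1 1 := by
      rintro rfl
      constructor
      · have : b * M 1 0 = 0 := by linear_combination -h0
        exact (mul_eq_zero.mp this).resolve_left hb
      · have : b * (M 0 0 - M 1 1) = 0 := by linear_combination h1
        exact sub_eq_zero.mp ((mul_eq_zero.mp this).resolve_left hb)
    rcases sgn he with h' | h'
    · exact key h'
    · by_cases h2' : (2 : F) = 0
      · exact key (by linear_combination h' - h2')
      · exfalso
        subst h'
        have e10 : M 1 0 = 0 := by
          have : (2 : F) * M 1 0 = 0 := by linear_combination h2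
          exact (mul_eq_zero.mp this).resolve_left h2'
        have e00 : M 0 0 = 0 := by
          have : (2 : F) * M 0 0 = 0 := by linear_combination h0 - b * e10
          exact (mul_eq_zero.mp this).resolve_left h2'
        rw [e10, e00] at hd
        simp at hd
  obtain ⟨h10, h00⟩ := main
  have hs : M 0 0 * M 0 0 = 1 := by
    linear_combination hd + M 0 0 * h00 + M 0 1 * h10
  refine ⟨M 0 0 * M 0 1, of_ent (M 0 0) hs ?_ ?_ ?_ ?_⟩
  · simp
  · simp; linear_combination -M 0 1 * hs
  · simp [h10]
  · simp [h00]

theorem comm_lo {M : SL F} {b : F} (hb : b ≠ 0) (h : pr M * pr (lo b) = pr (lo b) * pr M) :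
    ∃ x, pr M = pr (lo x) := by
  have e : lo b = ww F * up (-b) * (ww F)⁻¹ := by rw [ww_up, neg_neg]
  have e2 : pr (lo b) = pr (ww F) * pr (up (-b)) * (pr (ww F))⁻¹ := by rw [e]; rfl
  rw [e2] at h
  have h' : pr ((ww F)⁻¹ * M * ww F) * pr (up (-b)) = pr (up (-b)) * pr ((ww F)⁻¹ * M * ww F) := by
    have e3 : pr ((ww F)⁻¹ * M * ww F) = (pr (ww F))⁻¹ * pr M * pr (ww F) := rfl
    rw [e3]
    have := congrArg (fun z => (pr (ww F))⁻¹ * z * pr (ww F)) h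

    convert this using 1 <;> group
  obtain ⟨x, hx⟩ := comm_up (neg_ne_zero.mpr hb) h'
  refine ⟨-x, ?_⟩
  rw [← ww_up]
  have e4 : pr (ww F * up x * (ww F)⁻¹) = pr (ww F) * pr (up x) * (pr (ww F))⁻¹ := rfl
  rw [e4, ← hx]
  have e3 : pr ((ww F)⁻¹ * M * ww F) = (pr (ww F))⁻¹ * pr M * pr (ww F) := rfl
  rw [e3]
  group

/-- lifts of `p`-elements have trace `2` up to sign -/
theorem trace_two {p : ℕ} [Fact p.Prime] [CharP F p] (x : PS F) (h : x ^ p = 1) :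
    ∃ M : SL F, x = pr M ∧ M 0 0 + M 1 1 = 2 := by
  induction x using QuotientGroup.induction_on with | _ M
  have h1 : pr (M ^ p) = pr 1 := h
  have h2 : M ^ p * M ^ p = 1 := by
    rcases pr_eq.mp h1 with h | h <;> rw [h] <;> simp
  have h3 : ((M : Matrix (Fin 2) (Fin 2) F) * M) ^ p = 1 := by
    have := congrArg (fun A : SL F => (A : Matrix (Fin 2) (Fin 2) F)) h2
    simp only [Matrix.SpecialLinearGroup.coe_mul, Matrix.SpecialLinearGroup.coe_pow,
      Matrix.SpecialLinearGroup.coe_one] at this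
    rw [(Commute.refl _).mul_pow, this]
  have h4 : ((M : Matrix (Fin 2) (Fin 2) F) * M - 1) ^ p = 0 := by
    rw [sub_pow_char_of_commute _ (Commute.one_right _), h3, one_pow, sub_self]
  have h5 : ((M : Matrix (Fin 2) (Fin 2) F) * M - 1).det = 0 := by
    have := congrArg Matrix.det h4
    rw [Matrix.det_pow, Matrix.det_zero] at this
    exact pow_eq_zero_iff (Fact.out : p.Prime).ne_zero |>.mp this
  have hd := det_eq M
  rw [Matrix.det_fin_two] at h5
  simp [Matrix.mul_apply, Fin.sum_univ_two] at h5
  have h6 : (2 - (M 0 0 + M 1 1)) * (2 + (M 0 0 + M 1 1)) = 0 := by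
    linear_combination h5 + (-(M 0 0 * M 1 1) + M 0 1 * M 1 0 - 3) * hd
  rcases mul_eq_zero.mp h6 with h | h
  · exact ⟨M, rfl, by linear_combination -h⟩
  · refine ⟨-M, pr_eq.mpr (Or.inr (by simp)), ?_⟩
    simp only [neg_ij]
    linear_combination -h

theorem tr_lo {M : SL F} (ht : M 0 0 + M 1 1 = 2) (h : M 1 0 ≠ 0) :
    ∃ t, up t * M * (up t)⁻¹ = lo (M 1 0) := by
  refine ⟨(1 - M 0 0) / M 1 0, ?_⟩
  have hd := det_eq M
  rw [mul_inv_eq_iff_eq_mul]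
  apply ext4 <;> simp [mul00, mul01, mul10, mul11] <;> field_simp
  · ring
  · linear_combination -hd + ht
  · linear_combination ht

theorem tr_up {M : SL F} (ht : M 0 0 + M 1 1 = 2) (h : M 1 0 = 0) : M = up (M 0 1) := by
  have hd := det_eq M
  have h0 : (M 0 0 - 1) * (M 0 0 - 1) = 0 := by
    linear_combination -hd - M 0 1 * h + M 0 0 * ht
  have h1 : M 0 0 = 1 := sub_eq_zero.mp (mul_self_eq_zero.mp h0)
  apply ext4 <;> simp [h, h1]
  linear_combination ht - h1

theorem up_pow (x : F) (n : ℕ) : up x ^ n = up (n * x) := by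
  induction n with
  | zero => simp [up_zero]
  | succ n ih => rw [pow_succ, ih, ← up_add]; congr 1; push_cast; ring
theorem lo_pow (x : F) (n : ℕ) : lo x ^ n = lo (n * x) := by
  induction n with
  | zero => simp [lo_zero]
  | succ n ih => rw [pow_succ, ih, ← lo_add]; congr 1; push_cast; ring

theorem normalize [Finite F] (α : MulAut (PS F)) : ∃ (g : PS F) (b c : F), b ≠ 0 ∧ c ≠ 0 ∧
    (MulAut.conj g * α) (pr (up 1)) = pr (up b) ∧ (MulAut.conj g * α) (pr (lo 1)) = pr (lo c) := by
  obtain ⟨p, _⟩ := CharP.exists F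
  have : Fact p.Prime := ⟨CharP.char_is_prime F p⟩
  have hup : ∀ β : MulAut (PS F), β (pr (up 1)) ^ p = 1 := by
    intro β
    rw [← map_pow]
    have : pr (up (1 : F)) ^ p = pr (up 1 ^ p) := rfl
    rw [this, up_pow, CharP.cast_eq_zero, zero_mul, up_zero]
    exact map_one β
  have hlo : ∀ β : MulAut (PS F), β (pr (lo 1)) ^ p = 1 := by
    intro β
    rw [← map_pow]
    have : pr (lo (1 : F)) ^ p = pr (lo 1 ^ p) := rfl
    rw [this, lo_pow, CharP.cast_eq_zero, zero_mul, lo_zero]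
    exact map_one β
  have upne : ∀ (β : MulAut (PS F)) b, β (pr (up 1)) = pr (up b) → b ≠ 0 := by
    rintro β b h rfl
    rw [up_zero] at h
    have h1 : β (pr (up 1)) = β 1 := by rw [h]; exact (map_one β).symm
    have h2 := β.injective h1
    have h3 : pr (up (1 : F)) = pr (up 0) := by rw [h2, up_zero]; rfl
    exact one_ne_zero (up_inj h3)
  have lone : ∀ (β : MulAut (PS F)) b, β (pr (lo 1)) = pr (lo b) → b ≠ 0 := by
    rintro β b h rfl
    rw [lo_zero] at h
    have h1 : β (pr (lo 1)) = β 1 := by rw [h]; exact (map_one β).symm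
    have h2 := β.injective h1
    have h3 : pr (lo (1 : F)) = pr (lo 0) := by rw [h2, lo_zero]; rfl
    exact one_ne_zero (lo_inj h3)
  -- step 1
  have s1 : ∃ (g : PS F) (b : F), (MulAut.conj g * α) (pr (up 1)) = pr (up b) := by
    obtain ⟨M, hM, ht⟩ := trace_two (p := p) _ (hup α)
    by_cases h : M 1 0 = 0
    · exact ⟨1, M 0 1, by rw [map_one, one_mul, hM, ← tr_up ht h]⟩
    · obtain ⟨t, ht⟩ := tr_lo ht h
      refine ⟨(pr (ww F))⁻¹ * pr (up t), - M 1 0, ?_⟩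
      rw [map_mul, mul_assoc, MulAut.mul_apply, MulAut.mul_apply, hM]
      have e1 : MulAut.conj (pr (up t)) (pr M) = pr (up t * M * (up t)⁻¹) := rfl
      have e2 : lo (M 1 0) = ww F * up (- M 1 0) * (ww F)⁻¹ := by rw [ww_up, neg_neg]
      rw [e1, ht, e2]
      have e3 : pr (ww F * up (- M 1 0) * (ww F)⁻¹) =
        MulAut.conj (pr (ww F)) (pr (up (- M 1 0))) := rfl
      rw [e3, map_inv, MulAut.inv_apply_self]
  obtain ⟨g, b, hb⟩ := s1
  have hb0 := upne _ b hb
  obtain ⟨M, hM, ht⟩ := trace_two (p := p) _ (hlo (MulAut.conj g * α))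
  have h : M 1 0 ≠ 0 := by
    intro h
    rw [tr_up ht h] at hM
    -- then images commute
    have hc : pr (up b) * pr (up (M 0 1)) = pr (up (M 0 1)) * pr (up b) := by
      rw [← pr_mul, ← pr_mul, ← up_add, ← up_add, add_comm]
    rw [← hb, ← hM, ← map_mul, ← map_mul] at hc
    have hc' := (MulAut.conj g * α).injective hc
    obtain ⟨x, hx⟩ := comm_lo one_ne_zero hc'
    obtain ⟨e, he, h0, h1, h2, h3⟩ := ent hx
    simp at h1
  obtain ⟨t, ht⟩ := tr_lo ht h
  have e0 : (MulAut.conj (pr (up t) * g) * α) = MulAut.conj (pr (up t)) * (MulAut.conj g * α) := by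
    rw [map_mul, mul_assoc]
  refine ⟨pr (up t) * g, b, M 1 0, hb0, h, ?_, ?_⟩
  · rw [e0, MulAut.mul_apply, hb]
    have e1 : MulAut.conj (pr (up t)) (pr (up b)) = pr (up t * up b * (up t)⁻¹) := rfl
    rw [e1]
    congr 1
    rw [mul_inv_eq_iff_eq_mul, ← up_add, ← up_add, add_comm]
  · rw [e0, MulAut.mul_apply, hM]
    have e1 : MulAut.conj (pr (up t)) (pr M) = pr (up t * M * (up t)⁻¹) := rfl
    rw [e1, ht]

theorem gen_eq (α β : MulAut (PS F)) (h1 : ∀ x, α (pr (up x)) = β (pr (up x)))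
    (h2 : ∀ x, α (pr (lo x)) = β (pr (lo x))) : α = β := by
  have h3 : ∀ A : SL F, A 1 0 ≠ 0 → α (pr A) = β (pr A) := by
    intro A hA
    have e : A = up ((A 0 0 - 1) / A 1 0) * lo (A 1 0) * up ((A 1 1 - 1) / A 1 0) := by
      have hd := det_eq A
      apply ext4 <;> simp [mul00, mul01, mul10, mul11] <;> field_simp
      · ring
      · linear_combination -hd
      · ring
    rw [e, pr_mul, pr_mul]
    simp only [map_mul, h1, h2]
  ext x
  induction x using QuotientGroup.induction_on with | _ A
  by_cases hA : A 1 0 = 0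
  · have h00 : A 0 0 ≠ 0 := by
      intro h
      have hd := det_eq A
      rw [hA, h] at hd
      simp at hd
    have e : A = lo (-1) * (lo 1 * A) := by
      rw [← mul_assoc, ← lo_add]; simp [lo_zero]
    have := h3 (lo 1 * A) (by simp [mul10, hA, h00])
    change α (pr A) = β (pr A)
    rw [e, pr_mul, map_mul, map_mul, this, h2]
  · exact h3 A hA

end AbSup

namespace AbSup
open Matrix

variable {F : Type*} [Field F]

theorem braid {x y : F} (h : x * y = -1) : up x * lo y * up x = lo y * up x * lo y := by
  apply ext4 <;>
    simp only [mul00, mul01, mul10, mul11, up00, up01, up10, up11, lo00, lo01, lo10, lo11]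
  · ring
  · linear_combination x * h
  · linear_combination -y * h
  · ring

theorem braid_conv {x y : F} (hx : x ≠ 0)
    (h : pr (up x * lo y * up x) = pr (lo y * up x * lo y)) : x * y = -1 := by
  obtain ⟨e, he, h0, h1, h2, h3⟩ := ent h
  simp [mul00, mul01, mul10, mul11] at h0 h1 h2 h3
  have key : e = 1 → x * y = -1 := by
    rintro rfl
    have : x * (x * y + 1) = 0 := by linear_combination h1
    have := (mul_eq_zero.mp this).resolve_left hx
    linear_combination this
  rcases sgn he with h' | h'
  · exact key h'
  · by_cases h2' : (2 : F) = 0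
    · exact key (by linear_combination h' - h2')
    · subst h'
      have : (2 : F) * (x * y + 1) = 0 := by linear_combination h0
      have := (mul_eq_zero.mp this).resolve_left h2'
      linear_combination this

theorem weyl {x y z : F} (k : F) (h : x * y = -1) (hk : k * x * x = - z) :
    up x * lo y * up x * up z = lo k * (up x * lo y * up x) := by
  have hx : x ≠ 0 := by rintro rfl; simp at h
  have hy : y = -1 / x := by field_simp; linear_combination h
  have hk' : z = - (k * x * x) := by linear_combination hk
  subst hy hk'
  apply ext4 <;>
    simp only [mul00, mul01, mul10, mul11, up00, up01, up10, up11, lo00, lo01, lo10, lo11] <;>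
    field_simp <;> ring

theorem frob [Finite F] (α : MulAut (PS F)) (c : F) (hc : c ≠ 0)
    (hu : α (pr (up 1)) = pr (up 1)) (hl : α (pr (lo 1)) = pr (lo c)) :
    ∃ s : F ≃+* F, α = qm F (Fm s) := by
  have hf : ∀ x, ∃ y, α (pr (up x)) = pr (up y) := by
    intro x
    obtain ⟨M, hM⟩ := QuotientGroup.mk_surjective (α (pr (up x)))
    rw [← hM]
    refine comm_up (b := 1) one_ne_zero ?_
    change QuotientGroup.mk M * _ = _ * QuotientGroup.mk M
    rw [hM, ← hu, ← map_mul, ← map_mul, ← pr_mul, ← pr_mul, ← up_add, ← up_add, add_comm]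
  have hg : ∀ x, ∃ y, α (pr (lo x)) = pr (lo y) := by
    intro x
    obtain ⟨M, hM⟩ := QuotientGroup.mk_surjective (α (pr (lo x)))
    rw [← hM]
    refine comm_lo (b := c) hc ?_
    change QuotientGroup.mk M * _ = _ * QuotientGroup.mk M
    rw [hM, ← hl, ← map_mul, ← map_mul, ← pr_mul, ← pr_mul, ← lo_add, ← lo_add, add_comm]
  choose f hf using hf
  choose g hg using hg
  have f_add : ∀ x y, f (x + y) = f x + f y := by
    intro x y
    apply up_inj
    rw [← hf, up_add, up_add, pr_mul, pr_mul, map_mul, hf, hf]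
  have g_add : ∀ x y, g (x + y) = g x + g y := by
    intro x y
    apply lo_inj
    rw [← hg, lo_add, lo_add, pr_mul, pr_mul, map_mul, hg, hg]
  have f1 : f 1 = 1 := up_inj (by rw [← hf, hu])
  have f0 : f 0 = 0 := by have := f_add 0 0; simpa using this
  have g0 : g 0 = 0 := by have := g_add 0 0; simpa using this
  have f_neg : ∀ x, f (-x) = - f x := by
    intro x
    have := f_add x (-x)
    rw [add_neg_cancel, f0] at this
    linear_combination -this
  have f_inj : Function.Injective f := by
    intro x y h
    apply up_inj
    apply α.injective
    rw [hf, hf, h]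
  have f_ne : ∀ x, x ≠ 0 → f x ≠ 0 := fun x hx h => hx (f_inj (h.trans f0.symm))
  have fg : ∀ x y, x * y = -1 → f x * g y = -1 := by
    intro x y h
    have hx : x ≠ 0 := by rintro rfl; simp at h
    apply braid_conv (f_ne x hx)
    have := congrArg (fun A => α (pr A)) (braid h)
    simpa only [pr_mul, map_mul, hf, hg] using this
  have tor : ∀ x y, x ≠ 0 → g (-y / (x * x)) = - f y / (f x * f x) := by
    intro x z hx
    have hfx := f_ne x hx
    have e1 : x * (-1 / x) = -1 := by field_simp
    have h1 := congrArg (fun A => α (pr A)) (weyl (z := z) (-z / (x * x)) e1 (by field_simp))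
    have h2 := congrArg pr (weyl (z := f z) (- f z / (f x * f x)) (fg _ _ e1) (by field_simp))
    simp only [pr_mul, map_mul, hf, hg] at h1 h2
    rw [h1] at h2
    exact lo_inj (mul_right_cancel h2)
  have f_div : ∀ x y, x ≠ 0 → y ≠ 0 → f (x * x / y) * f y = f x * f x := by
    intro x y hx hy
    have h1 := fg (x * x / y) (-y / (x * x)) (by field_simp)
    rw [tor x y hx] at h1
    have hfx := f_ne x hx
    have e : f (x * x / y) * (- f y / (f x * f x)) = - (f (x * x / y) * f y) / (f x * f x) := by ring
    rw [e, div_eq_iff (mul_ne_zero hfx hfx)] at h1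
    linear_combination -h1
  have f_sqm : ∀ x z, f (x * x * z) = f x * f x * f z := by
    intro x z
    by_cases hx : x = 0
    · simp [hx, f0]
    by_cases hz : z = 0
    · simp [hz, f0]
    have h1 := f_div x z⁻¹ hx (inv_ne_zero hz)
    have h2 := f_div 1 z one_ne_zero hz
    rw [f1] at h2
    simp only [div_inv_eq_mul, one_mul, one_div] at h1 h2
    linear_combination f z * h1 - f (x * x * z) * h2
  have f_mul : ∀ x y, f (x * y) = f x * f y := by
    intro x y
    by_cases h2 : (2 : F) = 0
    · have hr : ringChar F = 2 := by
        have : CharP F 2 := CharTwo.of_one_ne_zero_of_two_eq_zero one_ne_zero h2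
        exact ringChar.eq F 2
      obtain ⟨t, rfl⟩ := FiniteField.isSquare_of_char_two hr x
      have := f_sqm t 1
      rw [f1, mul_one, mul_one] at this
      rw [f_sqm, this]
    · have h3 := f_sqm (x + 1) y
      have e : (x + 1) * (x + 1) * y = x * x * y + (x * y + x * y) + y := by ring
      rw [e, f_add, f_add, f_add, f_add, f_sqm, f1] at h3
      have : (2 : F) * (f (x * y) - f x * f y) = 0 := by linear_combination h3
      exact sub_eq_zero.mp ((mul_eq_zero.mp this).resolve_left h2)
  let φ : F →+* F := { toFun := f, map_one' := f1, map_mul' := f_mul, map_zero' := f0, map_add' := f_add }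
  let s : F ≃+* F := RingEquiv.ofBijective φ (Finite.injective_iff_bijective.mp f_inj)
  have hs : ∀ x, s x = f x := fun _ => rfl
  refine ⟨s, gen_eq _ _ ?_ ?_⟩
  · intro x
    rw [hf, qm_pr]
    congr 1
    apply ext4 <;> simp [hs, f1, f0]
  · intro x
    have gx : g x = f x := by
      by_cases hx : x = 0
      · rw [hx, f0, g0]
      have h1 := tor 1 (-x) one_ne_zero
      rw [f1, f_neg] at h1
      simpa using h1
    rw [hg, qm_pr, gx]
    congr 1
    apply ext4 <;> simp [hs, f1, f0]

theorem aut_class [Finite F] (α : MulAut (PS F)) :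
    ∃ (g : PS F) (a : Fˣ) (s : F ≃+* F), α = MulAut.conj g * qm F (Dm a) * qm F (Fm s) := by
  obtain ⟨g, b, c, hb, hc, h1, h2⟩ := normalize α
  let u : Fˣ := Units.mk0 b hb
  obtain ⟨s, hs⟩ := frob (qm F (Dm u⁻¹) * (MulAut.conj g * α)) (b * c) (mul_ne_zero hb hc) (by
      rw [MulAut.mul_apply, h1, qm_pr]
      congr 1
      apply ext4 <;> simp [u, hb]) (by
      rw [MulAut.mul_apply, h2, qm_pr]
      congr 1
      apply ext4 <;> simp [u])
  refine ⟨g⁻¹, u, s, ?_⟩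
  rw [← hs]
  have : qm F (Dm u) * qm F (Dm u⁻¹) = 1 := by
    rw [← map_mul, ← Dm_mul, mul_inv_cancel, Dm_one, map_one]
  rw [mul_assoc, ← mul_assoc (qm F (Dm u)), this, map_inv]
  group

end AbSup

namespace AbSup
open Matrix

variable {F : Type*} [Field F]

noncomputable def dh (F : Type*) [Field F] : Fˣ →* MulAut (PS F) where
  toFun a := qm F (Dm a)
  map_one' := by rw [Dm_one, map_one]
  map_mul' a b := by rw [Dm_mul, map_mul]

noncomputable def fh (F : Type*) [Field F] : (F ≃+* F) →* MulAut (PS F) where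
  toFun a := qm F (Fm a)
  map_one' := by rw [Fm_one, map_one]
  map_mul' a b := by rw [Fm_mul, map_mul]

theorem fh_dh (s : F ≃+* F) (a : Fˣ) :
    fh F s * dh F a = dh F (Units.map (s : F →* F) a) * fh F s := by
  change qm F (Fm s) * qm F (Dm a) = qm F _ * qm F (Fm s)
  rw [← map_mul, ← map_mul, Fm_Dm]

theorem dh_sq (a : Fˣ) : dh F (a * a) ∈ (MulAut.conj : PS F →* MulAut (PS F)).range := by
  refine ⟨pr (dg a), ?_⟩
  rw [← qm_conj, ← Dm_sq]
  rfl

theorem inn_normal {P : Type*} [Group P] : (MulAut.conj : P →* MulAut P).range.Normal := by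
  constructor
  rintro _ ⟨g, rfl⟩ α
  refine ⟨α g, ?_⟩
  ext x
  simp [MulAut.mul_apply]

theorem nonsq [Finite F] {n a : Fˣ} (hn : ¬ IsSquare (n : F)) (ha : ¬ IsSquare (a : F)) :
    ∃ c : Fˣ, (a : F) = c * c * n := by
  classical
  have := Fintype.ofFinite F
  have h1 := quadraticChar_neg_one_iff_not_isSquare.mpr hn
  have h2 := quadraticChar_neg_one_iff_not_isSquare.mpr ha
  have h3 : quadraticChar F (a * n) = 1 := by rw [map_mul, h1, h2]; norm_num
  obtain ⟨r, hr⟩ := (quadraticChar_one_iff_isSquare (mul_ne_zero a.ne_zero n.ne_zero)).mp h3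
  have hr0 : r ≠ 0 := by
    rintro rfl
    exact mul_ne_zero a.ne_zero n.ne_zero (by rw [hr]; simp)
  refine ⟨Units.mk0 r hr0 / n, ?_⟩
  have hn0 := n.ne_zero
  simp
  field_simp
  linear_combination hr

/-- pairs (semilinear diagonal map, its field automorphism) -/
noncomputable def Rr (F : Type*) [Field F] : Subgroup (MulAut (PS F) × (F ≃+* F)) where
  carrier := {x | ∃ b, x.1 = dh F b * fh F x.2}
  one_mem' := ⟨1, by simp⟩
  mul_mem' := by
    rintro ⟨x, s⟩ ⟨y, t⟩ ⟨a, ha⟩ ⟨b, hb⟩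
    simp only at ha hb
    refine ⟨a * Units.map (s : F →* F) b, ?_⟩
    simp only [Prod.mk_mul_mk]
    rw [ha, hb, map_mul, map_mul, mul_assoc (dh F a), ← mul_assoc (fh F s), fh_dh]
    simp only [mul_assoc]
  inv_mem' := by
    rintro ⟨x, s⟩ ⟨a, ha⟩
    simp only at ha
    refine ⟨Units.map ((s⁻¹ : F ≃+* F) : F →* F) a⁻¹, ?_⟩
    simp only [Prod.inv_mk]
    rw [← fh_dh, ha, _root_.mul_inv_rev, map_inv, map_inv]

theorem main_aut [Finite F] (S : Subgroup (MulAut (PS F)))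
    (hS : (MulAut.conj : PS F →* MulAut (PS F)).range ≤ S) :
    ∃ A : Subgroup (MulAut (PS F)), A ≤ S ∧ (∀ x ∈ A, ∀ y ∈ A, x * y = y * x) ∧
      S ≤ A ⊔ (MulAut.conj : PS F →* MulAut (PS F)).range := by
  set I := (MulAut.conj : PS F →* MulAut (PS F)).range with hI
  let K0 : Subgroup (F ≃+* F) := (Rr F ⊓ S.prod ⊤).map (MonoidHom.snd _ _)
  have hK : ∀ a s, dh F a * fh F s ∈ S → s ∈ K0 := by
    intro a s h
    exact ⟨(dh F a * fh F s, s), ⟨⟨a, rfl⟩, h, trivial⟩, rfl⟩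
  have : IsCyclic (F ≃+* F) := cyc
  obtain ⟨⟨s0, hs0⟩, hgen⟩ := IsCyclic.exists_generator (α := K0)
  have hgen' : ∀ s ∈ K0, ∃ k : ℤ, s0 ^ k = s := by
    intro s hs
    obtain ⟨k, hk⟩ := hgen ⟨s, hs⟩
    exact ⟨k, congrArg Subtype.val hk⟩
  obtain ⟨⟨t, s0'⟩, ⟨htR, htS, -⟩, h0⟩ := id hs0
  obtain rfl : s0' = s0 := h0
  simp only at htS
  have hpow : ∀ k : ℤ, ∃ b, t ^ k = dh F b * fh F (s0' ^ k) := fun k => (Rr F).zpow_mem htR k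
  by_cases hc : ∀ a, dh F a ∈ S → dh F a ∈ I
  · refine ⟨Subgroup.zpowers t, by simpa using htS, ?_, ?_⟩
    · rintro _ ⟨i, rfl⟩ _ ⟨j, rfl⟩
      exact (Commute.refl t).zpow_zpow i j
    · intro x hx
      obtain ⟨g, a, s, hxe⟩ := aut_class x
      have hg : MulAut.conj g ∈ I := ⟨g, rfl⟩
      have hx' : dh F a * fh F s ∈ S := by
        have e : dh F a * fh F s = (MulAut.conj g)⁻¹ * x := by
          rw [hxe, mul_assoc, inv_mul_cancel_left]; rfl
        rw [e]
        exact S.mul_mem (S.inv_mem (hS hg)) hx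
      obtain ⟨k, rfl⟩ := hgen' s (hK a s hx')
      obtain ⟨b, hb⟩ := hpow k
      have e : dh F a * fh F (s0' ^ k) = dh F (a / b) * t ^ k := by
        rw [hb, map_div, ← mul_assoc, div_mul_cancel]
      have hd : dh F (a / b) ∈ S := by
        rw [e] at hx'
        exact (S.mul_mem_cancel_right (S.zpow_mem htS k)).mp hx'
      have e2 : x = MulAut.conj g * (dh F (a / b) * t ^ k) := by
        rw [← e, hxe, mul_assoc]; rfl
      rw [e2]
      refine mul_mem (Subgroup.mem_sup_right hg) (mul_mem (Subgroup.mem_sup_right (hc _ hd)) ?_)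
      exact Subgroup.mem_sup_left ⟨k, rfl⟩
  · push Not at hc
    obtain ⟨n, hnS, hnI⟩ := hc
    have hn : ¬ IsSquare (n : F) := by
      rintro ⟨r, hr⟩
      have hr0 : r ≠ 0 := by rintro rfl; exact n.ne_zero (by rw [hr]; simp)
      apply hnI
      have : n = Units.mk0 r hr0 * Units.mk0 r hr0 := by ext; simpa using hr
      rw [this]
      exact dh_sq _
    have hall : ∀ T : Subgroup (MulAut (PS F)), I ≤ T → dh F n ∈ T → ∀ a, dh F a ∈ T := by
      intro T hT hnT a
      by_cases ha : IsSquare (a : F)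
      · obtain ⟨r, hr⟩ := ha
        have hr0 : r ≠ 0 := by rintro rfl; exact a.ne_zero (by rw [hr]; simp)
        have : a = Units.mk0 r hr0 * Units.mk0 r hr0 := by ext; simpa using hr
        rw [this]
        exact hT (dh_sq _)
      · obtain ⟨c, hc⟩ := nonsq hn ha
        have : a = c * c * n := by ext; simpa using hc
        rw [this, map_mul]
        exact T.mul_mem (hT (dh_sq _)) hnT
    have hsn : ¬ IsSquare ((Units.map (s0' : F →* F) n : Fˣ) : F) := by
      rintro ⟨r, hr⟩
      apply hn
      refine ⟨s0'.symm r, ?_⟩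
      rw [← map_mul, ← hr]
      simp
    obtain ⟨c, hc⟩ := nonsq hn hsn
    have hcomm := congrArg (qm F) (key_comm s0' c n (by simpa using hc))
    simp only [map_mul, qm_conj] at hcomm
    set y := dh F n * MulAut.conj (pr (ww F)) with hy
    set τ := dh F c⁻¹ * fh F s0' with hτ
    have hcomm' : τ * y = y * τ := hcomm
    have hw : MulAut.conj (pr (ww F)) ∈ I := ⟨_, rfl⟩
    have hyS : y ∈ S := S.mul_mem hnS (hS hw)
    have hfS : fh F s0' ∈ S := by
      obtain ⟨b, hb⟩ := htR
      simp only at hb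
      rw [hb] at htS
      exact (S.mul_mem_cancel_left (hall S hS hnS b)).mp htS
    have hτS : τ ∈ S := S.mul_mem (hall S hS hnS _) hfS
    let A := Subgroup.closure {y, τ}
    have hyA : y ∈ A := Subgroup.subset_closure (by simp)
    have hτA : τ ∈ A := Subgroup.subset_closure (by simp)
    refine ⟨A, ?_, ?_, ?_⟩
    · rw [Subgroup.closure_le]
      rintro z (rfl | rfl)
      · exact hyS
      · exact hτS
    · have hcl : ∀ x ∈ ({y, τ} : Set (MulAut (PS F))), ∀ z ∈ ({y, τ} : Set (MulAut (PS F))),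
          x * z = z * x := by
        rintro x (rfl | rfl) z (rfl | rfl)
        · rfl
        · exact hcomm'.symm
        · exact hcomm'
        · rfl
      have := Subgroup.isMulCommutative_closure hcl
      intro x hx z hz
      exact congrArg Subtype.val (mul_comm' (⟨x, hx⟩ : A) ⟨z, hz⟩)
    · have hnT : dh F n ∈ A ⊔ I := by
        have : dh F n = y * (MulAut.conj (pr (ww F)))⁻¹ := by rw [hy, mul_inv_cancel_right]
        rw [this]
        exact mul_mem (Subgroup.mem_sup_left hyA) (Subgroup.mem_sup_right (I.inv_mem hw))
      have hdT := hall (A ⊔ I) le_sup_right hnT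
      have hfT : fh F s0' ∈ A ⊔ I := by
        refine ((A ⊔ I).mul_mem_cancel_left (hdT c⁻¹)).mp ?_
        exact Subgroup.mem_sup_left hτA
      intro x hx
      obtain ⟨g, a, s, hxe⟩ := aut_class x
      have hg : MulAut.conj g ∈ I := ⟨g, rfl⟩
      have hx' : dh F a * fh F s ∈ S := by
        have e : dh F a * fh F s = (MulAut.conj g)⁻¹ * x := by
          rw [hxe, mul_assoc, inv_mul_cancel_left]; rfl
        rw [e]
        exact S.mul_mem (S.inv_mem (hS hg)) hx
      obtain ⟨k, rfl⟩ := hgen' s (hK a s hx')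
      rw [hxe]
      refine mul_mem (mul_mem (Subgroup.mem_sup_right hg) (hdT a)) ?_
      change fh F (s0' ^ k) ∈ _
      rw [map_zpow]
      exact (A ⊔ I).zpow_mem hfT k

end AbSup

/-- A finite almost simple group whose socle is isomorphic to `PSL(2,q)`, `q ≥ 4` a prime
power, has an abelian supplement to its socle. -/
theorem abelian_supplements_stmt_6
    (q : ℕ) (hq4 : 4 ≤ q) (F : Type*) [Field F] [Fintype F] (hcard : Fintype.card F = q)
    (G : Type*) [Group G] [Finite G] (G₀ : Subgroup G) [G₀.Normal]
    (hsimple : IsSimpleGroup G₀) (hnonab : ∃ x y : G₀, x * y ≠ y * x)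
    (hcent : Subgroup.centralizer (G₀ : Set G) = ⊥)
    (hiso : Nonempty (G₀ ≃* (Matrix.SpecialLinearGroup (Fin 2) F ⧸
      Subgroup.center (Matrix.SpecialLinearGroup (Fin 2) F)))) :
    ∃ A : Subgroup G, (∀ x y : A, (x : G) * y = (y : G) * x) ∧ A ⊔ G₀ = ⊤ := by
  obtain ⟨e⟩ := hiso
  let Φ : G →* MulAut (AbSup.PS F) := (MulAut.congr e).toMonoidHom.comp MulAut.conjNormal
  have hΦ : ∀ g x, Φ g x = e (MulAut.conjNormal g (e.symm x)) := fun _ _ => rfl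
  have hinj : Function.Injective Φ := by
    rw [injective_iff_map_eq_one]
    intro g hg
    have : g ∈ Subgroup.centralizer (G₀ : Set G) := by
      rw [Subgroup.mem_centralizer_iff]
      intro h hh
      have h1 := hΦ g (e ⟨h, hh⟩)
      rw [hg, MulAut.one_apply, e.symm_apply_apply] at h1
      have h2 := congrArg Subtype.val (e.injective h1)
      rw [MulAut.conjNormal_apply] at h2
      simp only at h2
      rw [eq_mul_inv_iff_mul_eq] at h2
      exact h2
    rw [hcent] at this
    exact Subgroup.mem_bot.mp this
  have hin : ∀ n : G₀, Φ n = MulAut.conj (e n) := by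
    intro n
    ext x
    rw [hΦ, MulAut.conj_apply]
    have : MulAut.conjNormal (n : G) (e.symm x) = n * e.symm x * n⁻¹ := by
      ext; simp [MulAut.conjNormal_apply]
    rw [this]
    simp
  obtain ⟨A, hAS, hAc, hSA⟩ := AbSup.main_aut (F := F) Φ.range (by
    rintro _ ⟨g, rfl⟩
    exact ⟨e.symm g, by rw [hin, e.apply_symm_apply]⟩)
  refine ⟨A.comap Φ, ?_, ?_⟩
  · rintro ⟨x, hx⟩ ⟨y, hy⟩
    apply hinj
    rw [map_mul, map_mul]
    exact hAc _ hx _ hy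
  · rw [eq_top_iff]
    intro x _
    have hN := AbSup.inn_normal (P := AbSup.PS F)
    obtain ⟨a, ha, n, hn, hx⟩ := Subgroup.mem_sup_of_normal_right.mp (hSA ⟨x, rfl⟩)
    obtain ⟨y, rfl⟩ := hAS ha
    obtain ⟨g, rfl⟩ := hn
    have h1 : Φ x = Φ (y * (e.symm g : G₀)) := by
      rw [map_mul, hin, e.apply_symm_apply, hx]
    rw [hinj h1]
    exact mul_mem (Subgroup.mem_sup_left ha) (Subgroup.mem_sup_right (e.symm g).2)
end

section
/- Let F be a finite field with q = p^m elements, ω a generator of F^×, and let w ≥ 2, l, c be integers, s ≥ 0, and ε ∈ {0,1}. If c·w ≡ l·p^s·(−1)^ε − l (mod q−1), then X_{w,c}⁻¹ · γ^ε(A_{w,l}^{[p^s]}) · X_{w,c} = ω^c · A_{w,l}, where γ denotes the inverse-transpose map γ(M) = (Mᵀ)⁻¹ on invertible matrices and γ^0 is the identity. -/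
open Matrix

/-- The weighted cyclic matrix with corner entry `b`. -/
def cycB {F : Type*} [Field F] (w : ℕ) (b : F) : Matrix (Fin w) (Fin w) F :=
  Matrix.of fun i j =>
    if (i : ℕ) = (j : ℕ) + 1 then 1
    else if (i : ℕ) = 0 ∧ (j : ℕ) = w - 1 then b else 0

theorem cycB_inv {F : Type*} [Field F] (w : ℕ) (hw : 2 ≤ w) (b : F) (hb : b ≠ 0) :
    ((cycB w b)ᵀ)⁻¹ = cycB w b⁻¹ := by
  apply Matrix.inv_eq_right_inv
  ext i j
  rw [Matrix.mul_apply]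
  by_cases hi : (i : ℕ) = w - 1
  · rw [Finset.sum_eq_single (⟨0, by omega⟩ : Fin w)]
    · by_cases hij : i = j
      · subst hij
        simp [cycB, hi, hb]
      · have : (j : ℕ) ≠ w - 1 := fun h => hij (Fin.ext (by omega))
        simp [cycB, this, hij]
    · intro k _ hk
      have h1 : (k : ℕ) ≠ 0 := fun h => hk (Fin.ext h)
      have h2 : (k : ℕ) ≠ i + 1 := by have := k.2; omega
      simp [cycB, h1, h2]
    · simp
  · have hlt : (i : ℕ) + 1 < w := by have := i.2; omega
    rw [Finset.sum_eq_single (⟨i + 1, hlt⟩ : Fin w)]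
    · by_cases hij : i = j
      · subst hij
        simp [cycB]
      · have : (i : ℕ) ≠ j := fun h => hij (Fin.ext h)
        simp [cycB, this, hij]
    · intro k _ hk
      have h2 : (k : ℕ) ≠ i + 1 := fun h => hk (Fin.ext h)
      simp [cycB, hi, h2]
    · simp

theorem cycB_conj {F : Type*} [Field F] (w : ℕ) (hw : 2 ≤ w) (ω : Fˣ) (c : ℤ) (a b : F)
    (h : b = ((ω ^ (c * w) : Fˣ) : F) * a) :
    (Matrix.diagonal fun i : Fin w => ((ω ^ (c * ((w - 1 - (i : ℕ) : ℕ) : ℤ)) : Fˣ) : F))⁻¹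
      * cycB w b
      * (Matrix.diagonal fun i : Fin w => ((ω ^ (c * ((w - 1 - (i : ℕ) : ℕ) : ℤ)) : Fˣ) : F))
      = ((ω ^ c : Fˣ) : F) • cycB w a := by
  set X := (Matrix.diagonal fun i : Fin w =>
    ((ω ^ (c * ((w - 1 - (i : ℕ) : ℕ) : ℤ)) : Fˣ) : F)) with hX
  have hdet : IsUnit X.det := by
    rw [hX, Matrix.det_diagonal, isUnit_iff_ne_zero, Finset.prod_ne_zero_iff]
    intro i _
    exact Units.ne_zero _
  have key : cycB w b * X = X * (((ω ^ c : Fˣ) : F) • cycB w a) := by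
    ext i j
    rw [hX, Matrix.mul_diagonal, Matrix.diagonal_mul, Matrix.smul_apply, smul_eq_mul, ← mul_assoc,
      ← Units.val_mul, ← _root_.zpow_add]
    by_cases h1 : (i : ℕ) = j + 1
    · have e : c * ((w - 1 - (j : ℕ) : ℕ) : ℤ) = c * ((w - 1 - (i : ℕ) : ℕ) : ℤ) + c := by
        have : w - 1 - (j : ℕ) = (w - 1 - (i : ℕ)) + 1 := by have := i.2; omega
        rw [this]; push_cast; ring
      simp only [cycB, Matrix.of_apply, if_pos h1, e, one_mul, mul_one]
    · by_cases h2 : (i : ℕ) = 0 ∧ (j : ℕ) = w - 1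
      · simp only [cycB, Matrix.of_apply, if_neg h1, if_pos h2]
        have e1 : c * ((w - 1 - (j : ℕ) : ℕ) : ℤ) = 0 := by
          rw [h2.2]; simp
        have e2 : c * ((w - 1 - (i : ℕ) : ℕ) : ℤ) + c = c * w := by
          have : (w : ℤ) = ((w - 1 - (i : ℕ) : ℕ) : ℤ) + 1 := by have := h2.1; omega
          rw [this]; ring
        rw [e1, e2, h]; simp
      · simp only [cycB, Matrix.of_apply, if_neg h1, if_neg h2, zero_mul, mul_zero]
  rw [Matrix.mul_assoc, key, ← Matrix.mul_assoc, Matrix.nonsing_inv_mul _ hdet, Matrix.one_mul]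

/-- Lemma: if `c·w ≡ l·p^s·(−1)^ε − l (mod q−1)` then
`X_{w,c}⁻¹ · γ^ε(A_{w,l}^{[p^s]}) · X_{w,c} = ω^c · A_{w,l}`, where `γ` is the
inverse-transpose map. -/
theorem abelian_supplements_stmt_8
    (p m q : ℕ) (hp : p.Prime) (hm : 0 < m) (hq : q = p ^ m)
    (F : Type*) [Field F] [Fintype F] [CharP F p] (hcard : Fintype.card F = q)
    (ω : Fˣ) (hω : Subgroup.zpowers ω = ⊤)
    (w : ℕ) (hw : 2 ≤ w) (l c : ℤ) (s : ℕ) (ε : ℕ) (hε : ε = 0 ∨ ε = 1)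
    (hcong : ((q : ℤ) - 1) ∣ c * w - (l * (p : ℤ) ^ s * (-1) ^ ε - l)) :
    let A : Matrix (Fin w) (Fin w) F := Matrix.of fun i j =>
      if (i : ℕ) = (j : ℕ) + 1 then 1
      else if (i : ℕ) = 0 ∧ (j : ℕ) = w - 1 then (-1 : F) ^ (w - 1) * ((ω ^ l : Fˣ) : F)
      else 0
    let X : Matrix (Fin w) (Fin w) F :=
      Matrix.diagonal fun i => ((ω ^ (c * ((w - 1 - (i : ℕ) : ℕ) : ℤ)) : Fˣ) : F)
    let A' : Matrix (Fin w) (Fin w) F := A.map fun x => x ^ p ^ s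
    let N : Matrix (Fin w) (Fin w) F := if ε = 1 then (A'ᵀ)⁻¹ else A'
    X⁻¹ * N * X = ((ω ^ c : Fˣ) : F) • A := by
  intro A X A' N
  haveI : Fact p.Prime := ⟨hp⟩
  have hord : ∀ z : ℤ, ((q : ℤ) - 1) ∣ z → ω ^ z = 1 := by
    rintro z ⟨k, rfl⟩
    have h1 : ω ^ ((q : ℤ) - 1) = 1 := by
      have h2 : (ω : F) ^ (Fintype.card F) = ω := FiniteField.pow_card _
      rw [hcard] at h2
      have h3 : ω ^ q = ω := Units.ext (by push_cast; exact h2)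
      rw [_root_.zpow_sub, _root_.zpow_natCast, h3]; simp
    rw [_root_.zpow_mul, h1, _root_.one_zpow]
  have hA : A = cycB w ((-1 : F) ^ (w - 1) * ((ω ^ l : Fˣ) : F)) := rfl
  have hneg : (-1 : F) ^ p ^ s = -1 := by
    have := map_neg (iterateFrobenius F p s) (1 : F)
    simpa [iterateFrobenius_def] using this
  have hps : p ^ s ≠ 0 := pow_ne_zero _ hp.ne_zero
  have hA' : A' = cycB w ((-1 : F) ^ (w - 1) * ((ω ^ (l * (p : ℤ) ^ s) : Fˣ) : F)) := by
    have e : ((-1 : F) ^ (w - 1) * ((ω ^ l : Fˣ) : F)) ^ p ^ s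
        = (-1 : F) ^ (w - 1) * ((ω ^ (l * (p : ℤ) ^ s) : Fˣ) : F) := by
      rw [mul_pow, ← pow_mul, mul_comm (w - 1), pow_mul, hneg, ← Units.val_pow_eq_pow_val,
        ← _root_.zpow_natCast (ω ^ l), ← _root_.zpow_mul]
      rw [Nat.cast_pow]
    rw [← e]
    ext i j
    change (A i j) ^ p ^ s = _
    rw [hA]
    simp only [cycB, Matrix.of_apply]
    split_ifs
    · simp
    · rfl
    · exact zero_pow hps
  have hcw : ∀ z : ℤ, ((q : ℤ) - 1) ∣ c * w - (z - l) → ω ^ z = ω ^ (c * w) * ω ^ l := by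
    intro z hz
    have := hord _ hz
    rw [← _root_.zpow_add, eq_comm, ← mul_inv_eq_one, ← _root_.zpow_neg, ← _root_.zpow_add, ← this]
    congr 1
    ring
  rw [hA]
  rcases hε with h0 | h1
  · have hN : N = A' := if_neg (by omega)
    rw [hN, hA']
    apply cycB_conj w hw
    subst h0
    rw [hcw (l * (p : ℤ) ^ s) (by simpa using hcong)]
    push_cast
    ring
  · have hN : N = (A'ᵀ)⁻¹ := if_pos h1
    rw [hN, hA', cycB_inv w hw _ (mul_ne_zero (pow_ne_zero _ (by simp)) (Units.ne_zero _))]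
    apply cycB_conj w hw
    subst h1
    have := hcw (-(l * (p : ℤ) ^ s)) (by simpa using hcong)
    rw [mul_inv, ← Units.val_inv_eq_inv_val, ← _root_.zpow_neg, this, ← _root_.inv_pow, inv_neg_one]
    push_cast
    ring
end

section
/- Let n and m be positive integers, let d = gcd(n, m), and let t be a positive divisor of d. Then there exists an integer y such that y·n ≡ d (mod m) and gcd(y, t) = 1. -/
/-- For positive integers `n`, `m` with `d = gcd(n,m)` and `t` a positive divisor of `d`,
there is an integer `y` with `y·n ≡ d (mod m)` and `gcd(y,t) = 1`. -/
theorem abelian_supplements_stmt_9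
    (n m : ℕ) (hn : 0 < n) (hm : 0 < m) (d t : ℕ)
    (hd : d = Nat.gcd n m) (ht : 0 < t) (htd : t ∣ d) :
    ∃ y : ℤ, (m : ℤ) ∣ y * n - d ∧ Int.gcd y (t : ℤ) = 1 := by
  obtain ⟨g, n', m', hg, hco, hn', hm'⟩ := Nat.exists_coprime' (m := n) (n := m) (Nat.gcd_pos_of_pos_left m hn)
  have hdg : d = g := by
    rw [hd, hn', hm', Nat.gcd_mul_right, hco.gcd_eq_one, one_mul]
  have hmm : m' ∣ m := ⟨g, hm'⟩
  have : NeZero m := ⟨hm.ne'⟩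
  obtain ⟨u, hu⟩ := ZMod.unitsMap_surjective hmm (ZMod.unitOfCoprime n' hco)⁻¹
  refine ⟨((u : ZMod m).val : ℤ), ?_, ?_⟩
  · have h1 : (((u : ZMod m).val : ℕ) : ZMod m') * (n' : ZMod m') = 1 := by
      have h2 : (((u : ZMod m).val : ℕ) : ZMod m') = ((ZMod.unitOfCoprime n' hco)⁻¹ : (ZMod m')ˣ) := by
        rw [← hu, ZMod.unitsMap_val, ZMod.natCast_val]
      rw [h2, ← ZMod.coe_unitOfCoprime n' hco, Units.inv_mul]
    have h3 : (m' : ℤ) ∣ ((u : ZMod m).val : ℤ) * n' - 1 := by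
      rw [← ZMod.intCast_zmod_eq_zero_iff_dvd]
      push_cast
      rw [h1, sub_self]
    obtain ⟨k, hk⟩ := h3
    refine ⟨k, ?_⟩
    have e1 : (n : ℤ) = n' * g := by exact_mod_cast hn'
    have e2 : (m : ℤ) = m' * g := by exact_mod_cast hm'
    rw [hdg, e1]
    linear_combination (g : ℤ) * hk - k * e2
  · rw [Int.gcd_natCast_natCast]
    exact (ZMod.val_coe_unit_coprime u).coprime_dvd_right
      (htd.trans (hd ▸ Nat.gcd_dvd_right n m))
end

section
/- Let F be a finite field with q = p^m elements, ω a generator of F^×, w ≥ 2, s ≥ 0, and let α, β be integers. If β ≡ 2α + p^s·β (mod q−1), then X_{w,β} = X_{w,α} · X_{w,β}^{[p^s]} · X_{w,α} (so that, via the preceding commuting criterion, the maps x ↦ X_{w,α}⁻¹·x^{[p^s]}·X_{w,α} and x ↦ X_{w,β}⁻¹·(xᵀ)⁻¹·X_{w,β} on invertible matrices commute). -/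
open Matrix

/-- If `β ≡ 2α + p^s·β (mod q−1)` then `X_{w,β} = X_{w,α} · X_{w,β}^{[p^s]} · X_{w,α}`,
and consequently the maps `x ↦ X_{w,α}⁻¹·x^{[p^s]}·X_{w,α}` and
`x ↦ X_{w,β}⁻¹·(xᵀ)⁻¹·X_{w,β}` commute on invertible matrices. -/
theorem abelian_supplements_stmt_11
    (p m q : ℕ) (hp : p.Prime) (hm : 0 < m) (hq : q = p ^ m)
    (F : Type*) [Field F] [Fintype F] [CharP F p] (hcard : Fintype.card F = q)
    (ω : Fˣ) (hω : Subgroup.zpowers ω = ⊤)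
    (w : ℕ) (hw : 2 ≤ w) (s : ℕ) (α β : ℤ)
    (hcong : ((q : ℤ) - 1) ∣ β - (2 * α + (p : ℤ) ^ s * β)) :
    let X : ℤ → Matrix (Fin w) (Fin w) F := fun c =>
      Matrix.diagonal fun i => ((ω ^ (c * ((w - 1 - (i : ℕ) : ℕ) : ℤ)) : Fˣ) : F)
    X β = X α * ((X β).map fun x => x ^ p ^ s) * X α ∧
      ∀ x : Matrix (Fin w) (Fin w) F, IsUnit x →
        (X α)⁻¹ * (((X β)⁻¹ * (xᵀ)⁻¹ * X β).map fun y => y ^ p ^ s) * X α =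
          (X β)⁻¹ * (((X α)⁻¹ * (x.map fun y => y ^ p ^ s) * X α)ᵀ)⁻¹ * X β := by
  intro X
  haveI : Fact p.Prime := ⟨hp⟩
  set φ : Matrix (Fin w) (Fin w) F →+* Matrix (Fin w) (Fin w) F :=
    (iterateFrobenius F p s).mapMatrix with hφ
  have hmap : ∀ M : Matrix (Fin w) (Fin w) F, (M.map fun y => y ^ p ^ s) = φ M := by
    intro M
    ext i j
    simp [hφ, iterateFrobenius_def]
  have hone : ω ^ (β - (2 * α + (p : ℤ) ^ s * β)) = 1 := by
    obtain ⟨k, hk⟩ := hcong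
    have h1 : ω ^ ((q : ℤ) - 1) = 1 := by
      have hc : ω ^ (Fintype.card F - 1) = 1 := by
        ext
        simpa using FiniteField.pow_card_sub_one_eq_one (ω : F) ω.ne_zero
      have hpos : 1 ≤ q := hcard ▸ Fintype.card_pos
      rw [hcard] at hc
      rw [← _root_.zpow_natCast] at hc
      rwa [Nat.cast_sub hpos, Nat.cast_one] at hc
    rw [hk, _root_.zpow_mul, h1, _root_.one_zpow]
  have hX : X β = X α * φ (X β) * X α := by
    rw [← hmap]
    simp only [X]
    rw [Matrix.diagonal_map (by simp [hp.ne_zero]), Matrix.diagonal_mul_diagonal,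
      Matrix.diagonal_mul_diagonal]
    congr 1
    funext i
    generalize ((w - 1 - (i : ℕ) : ℕ) : ℤ) = n
    try simp only [Function.comp]
    rw [← Units.val_pow_eq_pow_val, ← Units.val_mul, ← Units.val_mul]
    congr 1
    rw [← _root_.zpow_natCast, ← _root_.zpow_mul, ← _root_.zpow_add, ← _root_.zpow_add, ← mul_inv_eq_one, ← _root_.zpow_neg,
      ← _root_.zpow_add]
    have : β * n + -(α * n + β * n * ((p ^ s : ℕ) : ℤ) + α * n)
        = (β - (2 * α + (p : ℤ) ^ s * β)) * n := by
      push_cast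
      ring
    rw [this, _root_.zpow_mul, hone, _root_.one_zpow]
  have hU : ∀ c, IsUnit (X c) := by
    intro c
    rw [Matrix.isUnit_iff_isUnit_det]
    simp only [X, Matrix.det_diagonal]
    rw [isUnit_iff_ne_zero, Finset.prod_ne_zero_iff]
    intro i _
    exact Units.ne_zero _
  have hT : ∀ c, (X c)ᵀ = X c := fun c => Matrix.diagonal_transpose _
  have hinv : ∀ M : Matrix (Fin w) (Fin w) F, IsUnit M → φ M⁻¹ = (φ M)⁻¹ := by
    intro M hM
    refine (Matrix.inv_eq_left_inv ?_).symm
    rw [← map_mul, Matrix.nonsing_inv_mul _ ((Matrix.isUnit_iff_isUnit_det _).1 hM), map_one]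
  refine ⟨by rw [hmap]; exact hX, ?_⟩
  intro x hx
  have hxT : IsUnit xᵀ := by
    rw [Matrix.isUnit_iff_isUnit_det, Matrix.det_transpose]
    exact (Matrix.isUnit_iff_isUnit_det _).1 hx
  have hφT : φ xᵀ = (φ x)ᵀ := by
    ext i j
    simp [hφ]
  have hA := (Matrix.isUnit_iff_isUnit_det _).1 (hU α)
  rw [hmap, hmap, map_mul, map_mul, hinv _ (hU β), hinv _ hxT, hφT]
  rw [Matrix.transpose_mul, Matrix.transpose_mul, Matrix.transpose_nonsing_inv, hT,
    Matrix.mul_inv_rev, Matrix.mul_inv_rev, Matrix.nonsing_inv_nonsing_inv _ hA]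
  have e1 : (X β)⁻¹ * X α = (X α)⁻¹ * (φ (X β))⁻¹ := by
    conv_lhs => rw [hX]
    rw [Matrix.mul_inv_rev, Matrix.mul_inv_rev, Matrix.mul_assoc, Matrix.mul_assoc,
      Matrix.nonsing_inv_mul _ hA, Matrix.mul_one]
  have e2 : (X α)⁻¹ * X β = φ (X β) * X α := by
    conv_lhs => rw [hX]
    rw [Matrix.mul_assoc, Matrix.nonsing_inv_mul_cancel_left _ _ hA]
  calc _ = ((X α)⁻¹ * (φ (X β))⁻¹) * ((φ x)ᵀ)⁻¹ * (φ (X β) * X α) := by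
        simp only [Matrix.mul_assoc]
    _ = _ := by
        rw [← e1, ← e2]
        simp only [Matrix.mul_assoc]
end
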